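/- Let Δ ≥ 3 be an integer. There exists a sequence of instances (𝒯_n, w_n), where each 𝒯_n is a finite tree of maximum degree at most Δ and w_n a weight function, such that taking for every n any centroid tree C_n of (𝒯_n, w_n), the ratio cost_{w_n}(C_n) / OPT(𝒯_n, w_n) converges to 2 − 1/2^Δ as n → ∞. -/

import Mathlib

open Filter Topology

universe u

variable {V : Type u}

/-- Rooted trees with vertices labelled by elements of `V`. -/
inductive RTree (V : Type u) : Type u where
  | node : V → List (RTree V) → RTree V

namespace RTree

/-- The root of a rooted tree. -/
def root : RTree V → V
  | node r _ => r

/-- The subtrees rooted at the children of the root. -/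
def children : RTree V → List (RTree V)
  | node _ ts => ts

/-- The list of pairs `(v, path from the root to v)` over all vertices `v` of the tree. -/
def pathsFrom : RTree V → List (V × List V)
  | node r ts =>
      (r, [r]) ::
        (ts.attach.map fun t => (t.1.pathsFrom.map fun p => (p.1, r :: p.2))).flatten
  decreasing_by
    simp only [RTree.node.sizeOf_spec]
    have := List.sizeOf_lt_of_mem t.2
    omega

/-- The vertex set of a rooted tree. -/
def vertSet (T : RTree V) : Set V := {v | ∃ p ∈ T.pathsFrom, p.1 = v}

/-- `Path_T(v)`: the set of vertices on the path in `T` from the root to `v`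
(including both endpoints). -/
def pathSet (T : RTree V) (v : V) : Set V := {x | ∃ p ∈ T.pathsFrom, p.1 = v ∧ x ∈ p.2}

/-- The depth of a vertex `v` in `T`; the root has depth 1. -/
noncomputable def depth (T : RTree V) (v : V) : ℕ := (T.pathSet v).ncard

/-- All subtrees of a rooted tree (including the tree itself). -/
def allSubtrees : RTree V → List (RTree V)
  | node r ts => node r ts :: (ts.attach.map fun t => t.1.allSubtrees).flatten
  decreasing_by
    simp only [RTree.node.sizeOf_spec]
    have := List.sizeOf_lt_of_mem t.2
    omega

/-- Two rooted trees are equivalent (represent the same search tree) if they have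
the same root-to-vertex paths. -/
def Equiv (T₁ T₂ : RTree V) : Prop := ∀ v, T₁.pathSet v = T₂.pathSet v

end RTree

/-- `x` and `y` are joined by a walk of `G` staying inside `s`. -/
def ReachIn (G : SimpleGraph V) (s : Set V) (x y : V) : Prop :=
  ∃ p : G.Walk x y, ∀ v ∈ p.support, v ∈ s

/-- The connected component of `x` in the subgraph of `G` induced by `s`. -/
def compIn (G : SimpleGraph V) (s : Set V) (x : V) : Set V := {y | ReachIn G s x y}

/-- The set of connected components of the subgraph of `G` induced by `s`. -/
def comps (G : SimpleGraph V) (s : Set V) : Set (Set V) := {c | ∃ x ∈ s, c = compIn G s x}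

/-- `s` induces a (nonempty) connected subgraph of `G`. -/
def ConnIn (G : SimpleGraph V) (s : Set V) : Prop :=
  s.Nonempty ∧ ∀ x ∈ s, ∀ y ∈ s, ReachIn G s x y

/-- The total weight of a set of vertices. -/
noncomputable def wsum (w : V → ℝ) (s : Set V) : ℝ := ∑ᶠ x ∈ s, w x

/-- `IsSearchTree G s T`: `T` is a search tree on the subgraph of `G` induced by `s`.
Its root `r` is a vertex of `s`, its vertex set is `s`, and the subtrees rooted at the
children of `r` are search trees on the connected components of the induced subgraph
on `s \ {r}` (one subtree for each component). -/
inductive IsSearchTree (G : SimpleGraph V) : Set V → RTree V → Prop where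
  | node {s : Set V} {r : V} {ts : List (RTree V)} :
      r ∈ s →
      (RTree.node r ts).vertSet = s →
      (∀ t ∈ ts, IsSearchTree G (compIn G (s \ {r}) t.root) t) →
      ts.Pairwise (fun t₁ t₂ => compIn G (s \ {r}) t₁.root ≠ compIn G (s \ {r}) t₂.root) →
      IsSearchTree G s (RTree.node r ts)

/-- The cost of a search tree: `∑_x w(x) · depth(x)`, the root having depth 1. -/
noncomputable def cost (w : V → ℝ) (T : RTree V) : ℝ :=
  ∑ᶠ v ∈ T.vertSet, w v * (T.depth v : ℝ)

/-- The optimum cost of a search tree on the subgraph of `G` induced by `s`. -/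
noncomputable def OPT (G : SimpleGraph V) (w : V → ℝ) (s : Set V) : ℝ :=
  sInf (cost w '' {T | IsSearchTree G s T})

/-- `v` is an `α`-centroid of the subgraph of `G` induced by `s` (with weights `w`):
every connected component of the induced subgraph on `s \ {v}` has weight at most
`α` times the weight of `s`. -/
def IsAlphaCentroid (G : SimpleGraph V) (w : V → ℝ) (α : ℝ) (s : Set V) (v : V) : Prop :=
  v ∈ s ∧ ∀ x ∈ s \ {v}, wsum w (compIn G (s \ {v}) x) ≤ α * wsum w s

/-- `v` is a centroid of the subgraph of `G` induced by `s` (with weights `w`). -/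
def IsCentroid (G : SimpleGraph V) (w : V → ℝ) (s : Set V) (v : V) : Prop :=
  v ∈ s ∧ ∀ x ∈ s \ {v}, wsum w (compIn G (s \ {v}) x) ≤ wsum w s / 2

/-- `T` is an `α`-centroid tree on the subgraph of `G` induced by `s`. -/
def IsAlphaCentroidTree (G : SimpleGraph V) (w : V → ℝ) (α : ℝ) (s : Set V) (T : RTree V) :
    Prop :=
  IsSearchTree G s T ∧ ∀ t ∈ T.allSubtrees, IsAlphaCentroid G w α t.vertSet t.root

/-- `T` is a centroid tree on the subgraph of `G` induced by `s`. -/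
def IsCentroidTree (G : SimpleGraph V) (w : V → ℝ) (s : Set V) (T : RTree V) : Prop :=
  IsSearchTree G s T ∧ ∀ t ∈ T.allSubtrees, IsCentroid G w t.vertSet t.root

/-- `cent(𝒯,w)`: the maximum cost of a centroid tree. -/
noncomputable def centCost (G : SimpleGraph V) (w : V → ℝ) (s : Set V) : ℝ :=
  sSup (cost w '' {T | IsCentroidTree G w s T})

/-- `centᵅ(𝒯,w)`: the maximum cost of an `α`-centroid tree (`0` if none exists, since
`sSup ∅ = 0` in `ℝ`). -/
noncomputable def centCostA (G : SimpleGraph V) (w : V → ℝ) (α : ℝ) (s : Set V) : ℝ :=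
  sSup (cost w '' {T | IsAlphaCentroidTree G w α s T})

/-- `b` is a child of `a` in the rooted tree `T`. -/
def ChildRel (T : RTree V) (a b : V) : Prop :=
  ∃ t ∈ T.allSubtrees, t.root = a ∧ ∃ t' ∈ t.children, t'.root = b

namespace RTree

theorem mem_pathsFrom_node {r : V} {ts : List (RTree V)} {p : V × List V} :
    p ∈ (node r ts).pathsFrom ↔
      p = (r, [r]) ∨ ∃ t ∈ ts, ∃ q ∈ t.pathsFrom, p = (q.1, r :: q.2) := by
  rw [pathsFrom]
  simp only [List.mem_cons, List.mem_flatten, List.mem_map, List.mem_attach, true_and,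
    Subtype.exists]
  constructor
  · rintro (h | ⟨l, ⟨t, ht, rfl⟩, hp⟩)
    · exact Or.inl h
    · obtain ⟨q, hq, rfl⟩ := List.mem_map.1 hp
      exact Or.inr ⟨t, ht, q, hq, rfl⟩
  · rintro (h | ⟨t, ht, q, hq, rfl⟩)
    · exact Or.inl h
    · exact Or.inr ⟨_, ⟨t, ht, rfl⟩, List.mem_map.2 ⟨q, hq, rfl⟩⟩

theorem mem_vertSet_node {r v : V} {ts : List (RTree V)} :
    v ∈ (node r ts).vertSet ↔ v = r ∨ ∃ t ∈ ts, v ∈ t.vertSet := by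
  simp only [vertSet, Set.mem_ofPred_eq, mem_pathsFrom_node]
  constructor
  · rintro ⟨p, rfl | ⟨t, ht, q, hq, rfl⟩, rfl⟩
    · exact Or.inl rfl
    · exact Or.inr ⟨t, ht, q, hq, rfl⟩
  · rintro (rfl | ⟨t, ht, q, hq, rfl⟩)
    · exact ⟨_, Or.inl rfl, rfl⟩
    · exact ⟨_, Or.inr ⟨t, ht, q, hq, rfl⟩, rfl⟩

theorem mem_pathSet_node {r v x : V} {ts : List (RTree V)} :
    x ∈ (node r ts).pathSet v ↔
      (v = r ∧ x = r) ∨ ∃ t ∈ ts, v ∈ t.vertSet ∧ (x = r ∨ x ∈ t.pathSet v) := by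
  simp only [vertSet, pathSet, Set.mem_ofPred_eq, mem_pathsFrom_node]
  constructor
  · rintro ⟨p, rfl | ⟨t, ht, q, hq, rfl⟩, rfl, hx⟩
    · exact Or.inl ⟨rfl, by simpa using hx⟩
    · refine Or.inr ⟨t, ht, ⟨q, hq, rfl⟩, ?_⟩
      rcases List.mem_cons.1 hx with hx | hx
      · exact Or.inl hx
      · exact Or.inr ⟨q, hq, rfl, hx⟩
  · rintro (⟨rfl, rfl⟩ | ⟨t, ht, ⟨q, hq, rfl⟩, rfl | ⟨q', hq', hv, hx⟩⟩)
    · exact ⟨_, Or.inl rfl, rfl, by simp⟩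
    · exact ⟨_, Or.inr ⟨t, ht, q, hq, rfl⟩, rfl, by simp⟩
    · exact ⟨_, Or.inr ⟨t, ht, q', hq', rfl⟩, hv, List.mem_cons_of_mem _ hx⟩

theorem mem_allSubtrees_node {r : V} {ts : List (RTree V)} {t : RTree V} :
    t ∈ (node r ts).allSubtrees ↔ t = node r ts ∨ ∃ t' ∈ ts, t ∈ t'.allSubtrees := by
  rw [allSubtrees]
  simp only [List.mem_cons, List.mem_flatten, List.mem_map, List.mem_attach, true_and,
    Subtype.exists]
  constructor
  · rintro (h | ⟨l, ⟨t', ht', rfl⟩, hp⟩)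
    · exact Or.inl h
    · exact Or.inr ⟨t', ht', hp⟩
  · rintro (h | ⟨t', ht', hp⟩)
    · exact Or.inl h
    · exact Or.inr ⟨_, ⟨t', ht', rfl⟩, hp⟩

theorem root_mem_vertSet (T : RTree V) : T.root ∈ T.vertSet := by
  cases T
  exact mem_vertSet_node.2 (Or.inl rfl)

end RTree

section Reach

variable {G : SimpleGraph V} {s t A B : Set V} {x y z : V}

theorem ReachIn.refl (hx : x ∈ s) : ReachIn G s x x :=
  ⟨.nil, by simpa using hx⟩

theorem ReachIn.symm (h : ReachIn G s x y) : ReachIn G s y x := by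
  obtain ⟨p, hp⟩ := h
  exact ⟨p.reverse, by simpa using hp⟩

theorem ReachIn.trans (h : ReachIn G s x y) (h' : ReachIn G s y z) : ReachIn G s x z := by
  obtain ⟨p, hp⟩ := h
  obtain ⟨q, hq⟩ := h'
  refine ⟨p.append q, fun v hv => ?_⟩
  rcases SimpleGraph.Walk.mem_support_append_iff _ _ |>.1 hv with hv | hv
  · exact hp v hv
  · exact hq v hv

theorem ReachIn.mono (hst : s ⊆ t) (h : ReachIn G s x y) : ReachIn G t x y := by
  obtain ⟨p, hp⟩ := h
  exact ⟨p, fun v hv => hst (hp v hv)⟩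

theorem ReachIn.of_adj (hx : x ∈ s) (hy : y ∈ s) (h : G.Adj x y) : ReachIn G s x y :=
  ⟨.cons h .nil, by simp [hx, hy]⟩

theorem ReachIn.left_mem (h : ReachIn G s x y) : x ∈ s := by
  obtain ⟨p, hp⟩ := h
  exact hp x p.start_mem_support

theorem ReachIn.right_mem (h : ReachIn G s x y) : y ∈ s := h.symm.left_mem

theorem ReachIn.of_closed (hA : ∀ u ∈ A, ∀ v ∈ s, G.Adj u v → v ∈ A) (hx : x ∈ A)
    (h : ReachIn G s x y) : ReachIn G A x y := by
  obtain ⟨p, hp⟩ := h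
  induction p with
  | nil => exact .refl hx
  | @cons u v w huv p ih =>
    have hv : v ∈ A := hA u hx v (hp v (by simp)) huv
    exact (ReachIn.of_adj hx hv huv).trans (ih hv fun a ha => hp a (by simp [ha]))

theorem compIn_subset : compIn G s x ⊆ s := fun _ hy => ReachIn.right_mem hy

theorem compIn_eq_of_mem (h : y ∈ compIn G s x) : compIn G s y = compIn G s x := by
  ext z
  exact ⟨fun hz => ReachIn.trans h hz, fun hz => (ReachIn.symm h).trans hz⟩

theorem compIn_union_left (hAB : ∀ a ∈ A, ∀ b ∈ B, ¬ G.Adj a b) (hx : x ∈ A) :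
    compIn G (A ∪ B) x = compIn G A x := by
  ext y
  refine ⟨ReachIn.of_closed ?_ hx, ReachIn.mono Set.subset_union_left⟩
  rintro u hu v (hv | hv) huv
  · exact hv
  · exact (hAB u hu v hv huv).elim

theorem ConnIn.compIn_eq (h : ConnIn G s) (hx : x ∈ s) : compIn G s x = s :=
  Set.Subset.antisymm compIn_subset fun y hy => h.2 x hx y hy

theorem connIn_compIn (hx : x ∈ s) : ConnIn G (compIn G s x) := by
  have key : ∀ y ∈ compIn G s x, ReachIn G (compIn G s x) x y := fun y hy =>
    ReachIn.of_closed (fun u hu v hv huv =>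
      ReachIn.trans hu (.of_adj (compIn_subset hu) hv huv)) (ReachIn.refl hx) hy
  exact ⟨⟨x, .refl hx⟩, fun y hy z hz => (key y hy).symm.trans (key z hz)⟩

theorem ConnIn.of_reach (hx : x ∈ s) (h : ∀ y ∈ s, ReachIn G s x y) : ConnIn G s :=
  ⟨⟨x, hx⟩, fun y hy z hz => (h y hy).symm.trans (h z hz)⟩

theorem ConnIn.union_of_adj (hA : ConnIn G A) (hB : ConnIn G B) (hx : x ∈ A) (hy : y ∈ B)
    (h : G.Adj x y) : ConnIn G (A ∪ B) := by
  refine .of_reach (Or.inl hx) ?_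
  rintro z (hz | hz)
  · exact (hA.2 x hx z hz).mono Set.subset_union_left
  · exact (ReachIn.of_adj (s := A ∪ B) (Or.inl hx) (Or.inr hy) h).trans
      ((hB.2 y hy z hz).mono Set.subset_union_right)

theorem connIn_singleton : ConnIn G {x} :=
  .of_reach rfl (by rintro y rfl; exact .refl rfl)

end Reach

/-- A list of rooted trees consisting of one search tree for each component of `G[s]`. -/
structure IsSearchForest (G : SimpleGraph V) (s : Set V) (ts : List (RTree V)) : Prop where
  exists_mem_iff : ∀ v, (∃ t ∈ ts, v ∈ t.vertSet) ↔ v ∈ s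
  isSearchTree : ∀ t ∈ ts, IsSearchTree G (compIn G s t.root) t
  pairwise : ts.Pairwise fun t₁ t₂ => compIn G s t₁.root ≠ compIn G s t₂.root

section Search

variable {G : SimpleGraph V} {s A B : Set V} {r : V} {ts : List (RTree V)}

theorem IsSearchTree.vertSet_eq {T : RTree V} (h : IsSearchTree G s T) : T.vertSet = s := by
  cases h
  assumption

theorem IsSearchForest.disjoint_vertSet (h : IsSearchForest G s ts) :
    ts.Pairwise fun t₁ t₂ => Disjoint t₁.vertSet t₂.vertSet := by
  refine h.pairwise.imp_of_mem fun {t₁ t₂} h₁ h₂ hne => ?_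
  rw [(h.isSearchTree _ h₁).vertSet_eq, (h.isSearchTree _ h₂).vertSet_eq,
    Set.disjoint_left]
  intro x hx₁ hx₂
  exact hne ((compIn_eq_of_mem hx₁).symm.trans (compIn_eq_of_mem hx₂))

theorem IsSearchForest.eq_of_mem (h : IsSearchForest G s ts) {t₁ t₂ : RTree V}
    (h₁ : t₁ ∈ ts) (h₂ : t₂ ∈ ts) {x : V} (hx₁ : x ∈ t₁.vertSet) (hx₂ : x ∈ t₂.vertSet) :
    t₁ = t₂ := by
  by_contra hne
  have : Std.Symm fun t₁ t₂ : RTree V => Disjoint t₁.vertSet t₂.vertSet :=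
    ⟨fun _ _ h => Disjoint.symm h⟩
  exact Set.disjoint_left.1 (h.disjoint_vertSet.forall h₁ h₂ hne) hx₁ hx₂

theorem isSearchTree_node_iff :
    IsSearchTree G s (.node r ts) ↔ r ∈ s ∧ IsSearchForest G (s \ {r}) ts := by
  constructor
  · intro h
    cases h with
    | node hr hs ht hp =>
      refine ⟨hr, fun v => ⟨?_, fun hv => ?_⟩, ht, hp⟩
      · rintro ⟨t, htt, hv⟩
        rw [(ht t htt).vertSet_eq] at hv
        exact compIn_subset hv
      · have : v ∈ (RTree.node r ts).vertSet := hs ▸ hv.1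
        exact (RTree.mem_vertSet_node.1 this).resolve_left hv.2
  · rintro ⟨hr, h⟩
    refine .node hr ?_ h.isSearchTree h.pairwise
    ext v
    rw [RTree.mem_vertSet_node, h.exists_mem_iff]
    constructor
    · rintro (rfl | hv)
      · exact hr
      · exact hv.1
    · intro hv
      by_cases hvr : v = r
      · exact Or.inl hvr
      · exact Or.inr ⟨hv, hvr⟩

theorem IsSearchTree.pathSet_subset {T : RTree V} (h : IsSearchTree G s T) (v : V) :
    T.pathSet v ⊆ s := by
  induction h with
  | @node s r ts hr hs ht hp ih =>
    intro x hx
    rcases RTree.mem_pathSet_node.1 hx with ⟨-, rfl⟩ | ⟨t, htt, -, rfl | hx⟩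
    · exact hr
    · exact hr
    · exact (compIn_subset (ih t htt hx)).1

theorem IsSearchTree.exists_top {T : RTree V} (h : IsSearchTree G s T) {S : Set V}
    (hS : ConnIn G S) (hSs : S ⊆ s) : ∃ y ∈ S, ∀ x ∈ S, y ∈ T.pathSet x := by
  induction h with
  | @node s r ts hr hs ht hp ih =>
    have hf := (isSearchTree_node_iff.1 (.node hr hs ht hp)).2
    by_cases hrS : r ∈ S
    · refine ⟨r, hrS, fun x hx => RTree.mem_pathSet_node.2 ?_⟩
      by_cases hxr : x = r
      · exact Or.inl ⟨hxr, rfl⟩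
      · obtain ⟨t, htt, hxt⟩ := (hf.exists_mem_iff x).2 ⟨hSs hx, hxr⟩
        exact Or.inr ⟨t, htt, hxt, Or.inl rfl⟩
    · have hS' : S ⊆ s \ {r} := fun x hx => ⟨hSs hx, fun hxr => hrS (hxr ▸ hx)⟩
      obtain ⟨x₀, hx₀⟩ := hS.1
      obtain ⟨t, htt, hxt⟩ := (hf.exists_mem_iff x₀).2 (hS' hx₀)
      rw [(ht t htt).vertSet_eq] at hxt
      have hSt : S ⊆ compIn G (s \ {r}) t.root := fun x hx =>
        ReachIn.trans hxt ((hS.2 x₀ hx₀ x hx).mono hS')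
      obtain ⟨y, hy, hyS⟩ := ih t htt hSt
      refine ⟨y, hy, fun x hx => RTree.mem_pathSet_node.2 (Or.inr ⟨t, htt, ?_, Or.inr (hyS x hx)⟩)⟩
      rw [(ht t htt).vertSet_eq]
      exact hSt hx

theorem IsSearchTree.depth_root (h : IsSearchTree G s (.node r ts)) :
    (RTree.node r ts).depth r = 1 := by
  have hf := (isSearchTree_node_iff.1 h).2
  rw [RTree.depth, Set.ncard_eq_one]
  refine ⟨r, Set.eq_singleton_iff_unique_mem.2
    ⟨RTree.mem_pathSet_node.2 (Or.inl ⟨rfl, rfl⟩), fun x hx => ?_⟩⟩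
  rcases RTree.mem_pathSet_node.1 hx with ⟨-, hx⟩ | ⟨t, ht, hr, -⟩
  · exact hx
  · exact (((hf.exists_mem_iff r).1 ⟨t, ht, hr⟩).2 rfl).elim

theorem IsSearchTree.depth_child [Finite V] (h : IsSearchTree G s (.node r ts)) {t : RTree V}
    (ht : t ∈ ts) {v : V} (hv : v ∈ t.vertSet) :
    (RTree.node r ts).depth v = t.depth v + 1 := by
  have hf := (isSearchTree_node_iff.1 h).2
  have hvr : v ∈ s \ {r} := (hf.exists_mem_iff v).1 ⟨t, ht, hv⟩
  have heq : (RTree.node r ts).pathSet v = insert r (t.pathSet v) := by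
    ext x
    rw [RTree.mem_pathSet_node, Set.mem_insert_iff]
    constructor
    · rintro (⟨h, -⟩ | ⟨t', ht', hv', hx⟩)
      · exact (hvr.2 h).elim
      · rwa [hf.eq_of_mem ht ht' hv hv']
    · exact fun hx => Or.inr ⟨t, ht, hv, hx⟩
  rw [RTree.depth, heq, Set.ncard_insert_of_notMem, RTree.depth]
  exact fun hr => (compIn_subset ((hf.isSearchTree t ht).pathSet_subset v hr)).2 rfl

theorem finsum_mem_of_forall_mem_iff [Finite V] {f : V → ℝ} :
    ∀ {ts : List (RTree V)} {s : Set V},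
      (ts.Pairwise fun t₁ t₂ => Disjoint t₁.vertSet t₂.vertSet) →
      (∀ v, (∃ t ∈ ts, v ∈ t.vertSet) ↔ v ∈ s) →
      ∑ᶠ v ∈ s, f v = (ts.map fun t => ∑ᶠ v ∈ t.vertSet, f v).sum
  | [], s, _, h => by
    have : s = ∅ := by
      ext v
      simp [← h v]
    simp [this]
  | t :: ts, s, hp, h => by
    have hs : s = t.vertSet ∪ {v | ∃ t ∈ ts, v ∈ t.vertSet} := by
      ext v
      simp [← h v]
    rw [List.pairwise_cons] at hp
    rw [hs, finsum_mem_union _ (Set.toFinite _) (Set.toFinite _), List.map_cons, List.sum_cons,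
      finsum_mem_of_forall_mem_iff (s := {v | ∃ t ∈ ts, v ∈ t.vertSet}) hp.2 fun v => Iff.rfl]
    rw [Set.disjoint_left]
    rintro v hv ⟨t', ht', hv'⟩
    exact Set.disjoint_left.1 (hp.1 t' ht') hv hv'

theorem wsum_insert [Finite V] {w : V → ℝ} {x : V} (hx : x ∉ s) :
    wsum w (insert x s) = w x + wsum w s :=
  finsum_mem_insert _ hx (Set.toFinite _)

theorem wsum_union [Finite V] {w : V → ℝ} (h : Disjoint A B) :
    wsum w (A ∪ B) = wsum w A + wsum w B :=
  finsum_mem_union h (Set.toFinite _) (Set.toFinite _)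

theorem wsum_singleton {w : V → ℝ} {x : V} : wsum w {x} = w x := finsum_mem_singleton

theorem wsum_le_wsum [Finite V] {w w' : V → ℝ} (hAB : A ⊆ B) (h : ∀ x ∈ A, w x ≤ w' x)
    (h₀ : ∀ x ∈ B, 0 ≤ w' x) : wsum w A ≤ wsum w' B := by
  cases nonempty_fintype V
  classical
  rw [wsum, wsum, finsum_mem_eq_toFinset_sum, finsum_mem_eq_toFinset_sum]
  refine (Finset.sum_le_sum fun x hx => h x (by simpa using hx)).trans
    (Finset.sum_le_sum_of_subset_of_nonneg (by simpa using hAB) fun x hx _ =>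
      h₀ x (by simpa using hx))

theorem IsSearchTree.cost_node [Finite V] {w : V → ℝ} (h : IsSearchTree G s (.node r ts)) :
    cost w (.node r ts) = wsum w s + (ts.map (cost w)).sum := by
  obtain ⟨hr, hf⟩ := isSearchTree_node_iff.1 h
  have hs : s = insert r (s \ {r}) := by simp [Set.insert_eq_of_mem hr]
  have hr' : r ∉ s \ {r} := fun h => h.2 rfl
  rw [cost, h.vertSet_eq, hs, finsum_mem_insert _ hr' (Set.toFinite _), wsum_insert hr', wsum,
    h.depth_root, finsum_mem_of_forall_mem_iff hf.disjoint_vertSet hf.exists_mem_iff,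
    finsum_mem_of_forall_mem_iff hf.disjoint_vertSet hf.exists_mem_iff, add_assoc,
    ← List.sum_map_add, Nat.cast_one, mul_one]
  congr 2
  refine List.map_congr_left fun t ht => ?_
  rw [cost, ← finsum_mem_add_distrib (Set.toFinite _)]
  refine finsum_mem_congr rfl fun v hv => ?_
  rw [h.depth_child ht hv]
  push_cast
  ring

theorem IsSearchForest.append (hA : IsSearchForest G A ts) {ts' : List (RTree V)}
    (hB : IsSearchForest G B ts') (hd : Disjoint A B) (hAB : ∀ a ∈ A, ∀ b ∈ B, ¬ G.Adj a b) :
    IsSearchForest G (A ∪ B) (ts ++ ts') := by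
  have hBA : ∀ b ∈ B, ∀ a ∈ A, ¬ G.Adj b a := fun b hb a ha h => hAB a ha b hb h.symm
  have rA : ∀ t ∈ ts, t.root ∈ A := fun t ht =>
    (hA.exists_mem_iff _).1 ⟨t, ht, t.root_mem_vertSet⟩
  have rB : ∀ t ∈ ts', t.root ∈ B := fun t ht =>
    (hB.exists_mem_iff _).1 ⟨t, ht, t.root_mem_vertSet⟩
  have cA : ∀ t ∈ ts, compIn G (A ∪ B) t.root = compIn G A t.root := fun t ht =>
    compIn_union_left hAB (rA t ht)
  have cB : ∀ t ∈ ts', compIn G (A ∪ B) t.root = compIn G B t.root := fun t ht => by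
    rw [Set.union_comm]
    exact compIn_union_left hBA (rB t ht)
  refine ⟨fun v => ?_, fun t ht => ?_, List.pairwise_append.2 ⟨?_, ?_, ?_⟩⟩
  · rw [Set.mem_union, ← hA.exists_mem_iff, ← hB.exists_mem_iff]
    simp only [List.mem_append, or_and_right, exists_or]
  · rcases List.mem_append.1 ht with ht | ht
    · rw [cA t ht]
      exact hA.isSearchTree t ht
    · rw [cB t ht]
      exact hB.isSearchTree t ht
  · exact hA.pairwise.imp_of_mem fun h₁ h₂ h => by rwa [cA _ h₁, cA _ h₂]
  · exact hB.pairwise.imp_of_mem fun h₁ h₂ h => by rwa [cB _ h₁, cB _ h₂]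
  · intro t ht t' ht' h
    rw [cA t ht, cB t' ht'] at h
    have : t.root ∈ compIn G B t'.root := h ▸ ReachIn.refl (rA t ht)
    exact Set.disjoint_left.1 hd (rA t ht) (compIn_subset this)

theorem IsSearchTree.isSearchForest {T : RTree V} (h : IsSearchTree G s T) (hs : ConnIn G s) :
    IsSearchForest G s [T] := by
  have hT : compIn G s T.root = s :=
    hs.compIn_eq (h.vertSet_eq ▸ T.root_mem_vertSet)
  exact ⟨by simp [h.vertSet_eq], by simpa [hT] using h, by simp⟩

theorem exists_isSearchForest [Finite V] (G : SimpleGraph V) (s : Set V) :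
    ∃ ts, IsSearchForest G s ts := by
  induction hn : s.ncard using Nat.strong_induction_on generalizing s with
  | _ n ih =>
    rcases s.eq_empty_or_nonempty with rfl | ⟨x, hx⟩
    · exact ⟨[], by simp, by simp, by simp⟩
    · have hxK : x ∈ compIn G s x := ReachIn.refl hx
      obtain ⟨ts, hts⟩ := ih _ (hn ▸ Set.ncard_lt_ncard (s := compIn G s x \ {x}) (t := s)
        ⟨Set.sdiff_subset.trans compIn_subset, fun h => (h hx).2 rfl⟩) _ rfl
      obtain ⟨ts', hts'⟩ := ih _ (hn ▸ Set.ncard_lt_ncard (s := s \ compIn G s x) (t := s)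
        ⟨Set.sdiff_subset, fun h => (h hx).2 hxK⟩) _ rfl
      have hT := (isSearchTree_node_iff.2 ⟨hxK, hts⟩).isSearchForest (connIn_compIn hx)
      refine ⟨_, (Set.union_sdiff_cancel (compIn_subset (G := G) (s := s) (x := x))) ▸
        hT.append hts' Set.disjoint_sdiff_right ?_⟩
      exact fun a ha b hb hab => hb.2 (ReachIn.trans ha (.of_adj (compIn_subset ha) hb.1 hab))

end Search

/-- Shapes of full binary trees. -/
inductive Shape : Type where
  | leaf : Shape
  | join : Shape → Shape → Shape

namespace Shape

/-- The number of nodes. -/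
def size : Shape → ℕ
  | leaf => 1
  | join l r => l.size + r.size + 1

/-- The cost of the centroid tree of a block of total weight `1`. -/
noncomputable def centroidCost (ρ : ℝ) : Shape → ℝ
  | leaf => 1
  | join l r => 1 + ρ * l.centroidCost ρ + ρ * r.centroidCost ρ

/-- A lower bound for the cost of search trees on a block of total weight `1`. -/
noncomputable def lowerCost (ρ : ℝ) : Shape → ℝ
  | leaf => 1
  | join l r => (1 - ρ) + ρ * l.lowerCost ρ + ρ * r.lowerCost ρ

/-- A leaf successively joined with `m` copies of `b`. -/
def spine (b : Shape) : ℕ → Shape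
  | 0 => leaf
  | m + 1 => join (spine b m) b

/-- The shape of the lower bound instance with `k` levels. -/
def tower (d : ℕ) : ℕ → Shape
  | 0 => leaf
  | k + 1 => spine (tower d k) d

end Shape

/-- `IsBlock G w w' ρ t s W p x`: the induced subgraph of `G` on `s` is a tree of total weight `W`
built according to the shape `t`. A leaf is a single vertex; a join consists of two blocks of
weight `ρ * W` and a new vertex `c` of weight `(1 - 2 * ρ) * W` that is adjacent to the center of
the first block and to the port of the second one. The port `p` of the join is `c`, its center `x`
is the center of the first block. The weight `w'` ignores the vertices introduced by joins. -/
inductive IsBlock (G : SimpleGraph V) (w w' : V → ℝ) (ρ : ℝ) :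
    Shape → Set V → ℝ → V → V → Prop where
  | leaf {x : V} {W : ℝ} : w x = W → w' x = W → IsBlock G w w' ρ .leaf {x} W x x
  | join {l r : Shape} {S R : Set V} {W : ℝ} {c a x b y : V} :
      IsBlock G w w' ρ l S (ρ * W) a x → IsBlock G w w' ρ r R (ρ * W) b y →
      c ∉ S → c ∉ R → Disjoint S R → (∀ u ∈ S, ∀ v ∈ R, ¬ G.Adj u v) →
      (∀ v ∈ S, G.Adj c v ↔ v = x) → (∀ v ∈ R, G.Adj c v ↔ v = b) →
      w c = (1 - 2 * ρ) * W → w' c = 0 →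
      IsBlock G w w' ρ (.join l r) (insert c (S ∪ R)) W c x

section Pieces

variable [Finite V] {w : V → ℝ} {s X : Set V} {P : V → Set V}

theorem finsum_mul_ncard_inter_le (hX : X ⊆ s) (hw : ∀ x ∈ X, 0 ≤ w x) :
    ∑ᶠ x ∈ X, w x * ((P x ∩ X).ncard : ℝ) ≤ ∑ᶠ x ∈ X, w x * ((P x ∩ s).ncard : ℝ) := by
  refine wsum_le_wsum Set.Subset.rfl (fun x hx => ?_) fun x hx =>
    mul_nonneg (hw x hx) (Nat.cast_nonneg _)
  gcongr
  · exact hw x hx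
  · exact Set.toFinite _

theorem finsum_mul_ncard_inter_add_wsum_le (hX : X ⊆ s) (hw : ∀ x ∈ X, 0 ≤ w x) {z : V}
    (hz : z ∈ s) (hzX : z ∉ X) (hP : ∀ x ∈ X, z ∈ P x) :
    ∑ᶠ x ∈ X, w x * ((P x ∩ X).ncard : ℝ) + wsum w X ≤
      ∑ᶠ x ∈ X, w x * ((P x ∩ s).ncard : ℝ) := by
  rw [wsum, ← finsum_mem_add_distrib (Set.toFinite _)]
  refine wsum_le_wsum Set.Subset.rfl (fun x hx => ?_) fun x hx =>
    mul_nonneg (hw x hx) (Nat.cast_nonneg _)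
  have : (P x ∩ X).ncard + 1 ≤ (P x ∩ s).ncard := by
    rw [← Set.ncard_insert_of_notMem (a := z) (s := P x ∩ X) fun h => hzX h.2]
    exact Set.ncard_le_ncard (Set.insert_subset ⟨hP x hx, hz⟩
      (Set.inter_subset_inter_right _ hX))
  have h1 : ((P x ∩ X).ncard : ℝ) + 1 ≤ (P x ∩ s).ncard := by exact_mod_cast this
  nlinarith [hw x hx]

theorem finsum_mem_insert_union {f : V → ℝ} {c : V} {S R : Set V} (hS : c ∉ S) (hR : c ∉ R)
    (hSR : Disjoint S R) :
    ∑ᶠ v ∈ insert c (S ∪ R), f v = f c + (∑ᶠ v ∈ S, f v + ∑ᶠ v ∈ R, f v) := by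
  rw [finsum_mem_insert _ (by simp [hS, hR]) (Set.toFinite _),
    finsum_mem_union hSR (Set.toFinite _) (Set.toFinite _)]

end Pieces

namespace IsBlock

variable {G : SimpleGraph V} {w w' : V → ℝ} {ρ W : ℝ} {t : Shape} {s : Set V} {p x : V}

theorem center_mem (h : IsBlock G w w' ρ t s W p x) : x ∈ s := by
  induction h with
  | leaf => rfl
  | join _ _ _ _ _ _ _ _ _ _ ih => exact Or.inr (Or.inl ih)

theorem port_mem (h : IsBlock G w w' ρ t s W p x) : p ∈ s := by
  cases h with
  | leaf => rfl
  | join => exact Or.inl rfl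

theorem connIn (h : IsBlock G w w' ρ t s W p x) : ConnIn G s := by
  induction h with
  | leaf => exact connIn_singleton
  | @join l r S R W c a x b y hl hr hcS hcR hSR hno hcx hcb hw hw' ihl ihr =>
    have h1 : ConnIn G ({c} ∪ S) :=
      connIn_singleton.union_of_adj ihl rfl hl.center_mem ((hcx x hl.center_mem).2 rfl)
    have h2 := h1.union_of_adj ihr (Or.inl rfl) hr.port_mem ((hcb b hr.port_mem).2 rfl)
    rwa [Set.union_assoc, Set.singleton_union] at h2

theorem ncard_eq [Finite V] (h : IsBlock G w w' ρ t s W p x) : s.ncard = t.size := by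
  induction h with
  | leaf => simp [Shape.size]
  | join hl hr hcS hcR hSR hno hcx hcb hw hw' ihl ihr =>
    rw [Set.ncard_insert_of_notMem (by simp [hcS, hcR]), Set.ncard_union_eq hSR, ihl, ihr,
      Shape.size]

theorem wsum_eq [Finite V] (h : IsBlock G w w' ρ t s W p x) : wsum w s = W := by
  induction h with
  | leaf h => rw [wsum_singleton, h]
  | join hl hr hcS hcR hSR hno hcx hcb hw hw' ihl ihr =>
    rw [wsum_insert (by simp [hcS, hcR]), wsum_union hSR, ihl, ihr, hw]
    ring

theorem weight_bounds (h : IsBlock G w w' ρ t s W p x) (hρ : 0 ≤ ρ) (hρ' : ρ ≤ 1 / 2)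
    (hW : 0 ≤ W) :
    ∀ v ∈ s, 0 ≤ w' v ∧ w' v ≤ w v ∧ w v ≤ w' v + (1 - 2 * ρ) * W := by
  induction h with
  | @leaf x W h h' =>
    rintro v rfl
    rw [h, h']
    refine ⟨hW, le_rfl, ?_⟩
    nlinarith
  | @join l r S R W c a x b y hl hr hcS hcR hSR hno hcx hcb hw hw' ihl ihr =>
    have hρW : (1 - 2 * ρ) * (ρ * W) ≤ (1 - 2 * ρ) * W := by
      gcongr
      · linarith
      · nlinarith
    rintro v (rfl | hv | hv)
    · rw [hw, hw']
      exact ⟨le_rfl, mul_nonneg (by linarith) hW, by linarith⟩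
    · obtain ⟨h1, h2, h3⟩ := ihl (mul_nonneg hρ hW) v hv
      exact ⟨h1, h2, by linarith⟩
    · obtain ⟨h1, h2, h3⟩ := ihr (mul_nonneg hρ hW) v hv
      exact ⟨h1, h2, by linarith⟩

theorem lowerCost_le [Finite V] (h : IsBlock G w w' ρ t s W p x) (hw₀ : ∀ v, 0 ≤ w v)
    (hρ : 0 ≤ ρ) (hW : 0 ≤ W) {P : V → Set V}
    (hP : ∀ S : Set V, ConnIn G S → ∃ y ∈ S, ∀ v ∈ S, y ∈ P v) :
    W * t.lowerCost ρ ≤ ∑ᶠ v ∈ s, w v * ((P v ∩ s).ncard : ℝ) := by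
  induction h with
  | @leaf x W h h' =>
    obtain ⟨y, rfl, hy⟩ := hP {x} connIn_singleton
    have : P y ∩ {y} = {y} := by simpa using hy
    rw [finsum_mem_singleton, this, Set.ncard_singleton, h, Shape.lowerCost, Nat.cast_one]
  | @join l r S R W c a x b y hl hr hcS hcR hSR hno hcx hcb hw hw' ihl ihr =>
    have hρW := mul_nonneg hρ hW
    have hconn := (IsBlock.join hl hr hcS hcR hSR hno hcx hcb hw hw').connIn
    obtain ⟨z, hz, hzP⟩ := hP _ hconn
    have hSs : S ⊆ insert c (S ∪ R) := fun v hv => Or.inr (Or.inl hv)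
    have hRs : R ⊆ insert c (S ∪ R) := fun v hv => Or.inr (Or.inr hv)
    have h0S : ∀ v ∈ S, 0 ≤ w v := fun v _ => hw₀ v
    have h0R : ∀ v ∈ R, 0 ≤ w v := fun v _ => hw₀ v
    have hS := finsum_mul_ncard_inter_le (P := P) hSs h0S
    have hR := finsum_mul_ncard_inter_le (P := P) hRs h0R
    have hS' : z ∉ S → _ := fun hzS => finsum_mul_ncard_inter_add_wsum_le (P := P) hSs h0S hz hzS
      fun v hv => hzP v (hSs hv)
    have hR' : z ∉ R → _ := fun hzR => finsum_mul_ncard_inter_add_wsum_le (P := P) hRs h0R hz hzR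
      fun v hv => hzP v (hRs hv)
    have hc : w c ≤ w c * ((P c ∩ insert c (S ∪ R)).ncard : ℝ) := by
      have : 1 ≤ (P c ∩ insert c (S ∪ R)).ncard :=
        Set.ncard_pos (Set.toFinite _) |>.2 ⟨z, hzP c (Or.inl rfl), hz⟩
      have : (1 : ℝ) ≤ (P c ∩ insert c (S ∪ R)).ncard := by exact_mod_cast this
      nlinarith [hw₀ c]
    have ihl := ihl hρW
    have ihr := ihr hρW
    rw [hl.wsum_eq] at hS'
    rw [hr.wsum_eq] at hR'
    rw [finsum_mem_insert_union hcS hcR hSR, Shape.lowerCost, hw]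
    rw [hw] at hc
    rcases hz with rfl | hz | hz
    · have := hS' hcS
      linarith
    · have := hR' (Set.disjoint_left.1 hSR hz)
      linarith
    · have := hS' (Set.disjoint_right.1 hSR hz)
      linarith

end IsBlock

theorem IsCentroidTree.child {G : SimpleGraph V} {w : V → ℝ} {s : Set V} {r : V}
    {ts : List (RTree V)} (h : IsCentroidTree G w s (.node r ts)) {t : RTree V} (ht : t ∈ ts) :
    IsCentroidTree G w t.vertSet t := by
  have := (isSearchTree_node_iff.1 h.1).2.isSearchTree t ht
  exact ⟨this.vertSet_eq ▸ this,
    fun t' ht' => h.2 t' (RTree.mem_allSubtrees_node.2 (Or.inr ⟨t, ht, ht'⟩))⟩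

theorem IsCentroidTree.wsum_le {G : SimpleGraph V} [Finite V] {w : V → ℝ} (hw : ∀ v, 0 ≤ w v)
    {s S : Set V} {r : V} {ts : List (RTree V)} (h : IsCentroidTree G w s (.node r ts))
    (hS : ConnIn G S) (hSs : S ⊆ s) (hr : r ∉ S) : wsum w S ≤ wsum w s / 2 := by
  have hc := h.2 _ (RTree.mem_allSubtrees_node.2 (Or.inl rfl))
  rw [h.1.vertSet_eq] at hc
  have hS' : S ⊆ s \ {r} := fun v hv => ⟨hSs hv, fun hvr => hr (hvr ▸ hv)⟩
  obtain ⟨v₀, hv₀⟩ := hS.1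
  refine le_trans (wsum_le_wsum ?_ (fun _ _ => le_rfl) fun v _ => hw v) (hc.2 v₀ (hS' hv₀))
  exact fun v hv => (hS.2 v₀ hv₀ v hv).mono hS'

theorem IsSearchForest.exists_vertSet_eq {G : SimpleGraph V} {A B : Set V} {ts : List (RTree V)}
    (h : IsSearchForest G (A ∪ B) ts) (hA : ConnIn G A) (hAB : ∀ a ∈ A, ∀ b ∈ B, ¬ G.Adj a b) :
    ∃ t ∈ ts, t.vertSet = A := by
  obtain ⟨v, hv⟩ := hA.1
  obtain ⟨t, ht, hvt⟩ := (h.exists_mem_iff v).2 (Or.inl hv)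
  have ht' := (h.isSearchTree t ht).vertSet_eq
  refine ⟨t, ht, ?_⟩
  rw [ht'] at hvt ⊢
  rw [← compIn_eq_of_mem hvt, compIn_union_left hAB hv, hA.compIn_eq hv]

theorem IsSearchTree.finsum_child [Finite V] {G : SimpleGraph V} {w : V → ℝ} {s : Set V} {r : V}
    {ts : List (RTree V)} (h : IsSearchTree G s (.node r ts)) {t : RTree V} (ht : t ∈ ts) :
    ∑ᶠ v ∈ t.vertSet, w v * ((RTree.node r ts).depth v : ℝ) = cost w t + wsum w t.vertSet := by
  rw [cost, wsum, ← finsum_mem_add_distrib (Set.toFinite _)]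
  refine finsum_mem_congr rfl fun v hv => ?_
  rw [h.depth_child ht hv]
  push_cast
  ring

theorem IsBlock.cost_centroidTree [Finite V] {G : SimpleGraph V} {w w' : V → ℝ} {ρ W : ℝ}
    {t : Shape} {s : Set V} {p x : V} (h : IsBlock G w w' ρ t s W p x) (hw₀ : ∀ v, 0 ≤ w v)
    (hρ : 0 < ρ) (hρ' : ρ < 1 / 2) (hW : 0 < W) {C : RTree V} (hC : IsCentroidTree G w s C) :
    cost w C = W * t.centroidCost ρ := by
  induction h generalizing C with
  | @leaf x W h h' =>
    obtain ⟨r, ts⟩ := C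
    obtain rfl : r = x := (isSearchTree_node_iff.1 hC.1).1
    rw [cost, hC.1.vertSet_eq, finsum_mem_singleton, hC.1.depth_root, h, Shape.centroidCost,
      Nat.cast_one]
  | @join l r S R W c a x b y hl hr hcS hcR hSR hno hcx hcb hw hw' ihl ihr =>
    have hρW := mul_pos hρ hW
    have hs := (IsBlock.join hl hr hcS hcR hSR hno hcx hcb hw hw').wsum_eq
    have hbig : W / 2 < (1 - 2 * ρ) * W + ρ * W := by nlinarith
    obtain ⟨r', ts⟩ := C
    have hr' := (isSearchTree_node_iff.1 hC.1).1
    have hrc : r' = c := by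
      rcases hr' with h | h | h
      · exact h
      · have h1 : ConnIn G ({c} ∪ R) := connIn_singleton.union_of_adj hr.connIn rfl
          hr.port_mem ((hcb b hr.port_mem).2 rfl)
        have h2 := hC.wsum_le hw₀ h1 (by
          rintro v (rfl | hv)
          · exact Or.inl rfl
          · exact Or.inr (Or.inr hv)) (by
          rintro (rfl | hv)
          · exact hcS h
          · exact Set.disjoint_left.1 hSR h hv)
        rw [Set.singleton_union, wsum_insert hcR, hw, hr.wsum_eq, hs] at h2
        linarith
      · have h1 : ConnIn G ({c} ∪ S) := connIn_singleton.union_of_adj hl.connIn rfl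
          hl.center_mem ((hcx x hl.center_mem).2 rfl)
        have h2 := hC.wsum_le hw₀ h1 (by
          rintro v (rfl | hv)
          · exact Or.inl rfl
          · exact Or.inr (Or.inl hv)) (by
          rintro (rfl | hv)
          · exact hcR h
          · exact Set.disjoint_left.1 hSR hv h)
        rw [Set.singleton_union, wsum_insert hcS, hw, hl.wsum_eq, hs] at h2
        linarith
    subst hrc
    have hf := (isSearchTree_node_iff.1 hC.1).2
    rw [Set.insert_sdiff_self_of_notMem (by simp [hcS, hcR])] at hf
    obtain ⟨tS, htS, hvS⟩ := hf.exists_vertSet_eq hl.connIn hno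
    obtain ⟨tR, htR, hvR⟩ := IsSearchForest.exists_vertSet_eq (Set.union_comm S R ▸ hf) hr.connIn
      fun u hu v hv huv => hno v hv u hu huv.symm
    have hcl := ihl hρW (hvS ▸ hC.child htS)
    have hcr := ihr hρW (hvR ▸ hC.child htR)
    have hsl := hC.1.finsum_child (w := w) htS
    have hsr := hC.1.finsum_child (w := w) htR
    rw [hvS, hl.wsum_eq, hcl] at hsl
    rw [hvR, hr.wsum_eq, hcr] at hsr
    rw [cost, hC.1.vertSet_eq, finsum_mem_insert_union hcS hcR hSR, hsl, hsr, hC.1.depth_root, hw,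
      Shape.centroidCost]
    push_cast
    ring

/-- The geometric sum `ρ + ρ ^ 2 + ⋯ + ρ ^ m`. -/
noncomputable def geomSum (ρ : ℝ) : ℕ → ℝ
  | 0 => 0
  | m + 1 => ρ + ρ * geomSum ρ m

/-- The limiting optimum cost of a search tree on a tower with `k` levels. -/
noncomputable def towerCost (ρ : ℝ) (d : ℕ) : ℕ → ℝ
  | 0 => 1
  | k + 1 => 1 + geomSum ρ d * towerCost ρ d k

theorem Shape.lowerCost_spine (ρ : ℝ) (b : Shape) (m : ℕ) :
    (b.spine m).lowerCost ρ = 1 + geomSum ρ m * b.lowerCost ρ := by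
  induction m with
  | zero => simp [spine, lowerCost, geomSum]
  | succ m ih =>
    rw [spine, lowerCost, ih, geomSum]
    ring

theorem Shape.centroidCost_spine (ρ : ℝ) (b : Shape) (m : ℕ) :
    (b.spine m).centroidCost ρ = 1 + geomSum ρ m + geomSum ρ m * b.centroidCost ρ := by
  induction m with
  | zero => simp [spine, centroidCost, geomSum]
  | succ m ih =>
    rw [spine, centroidCost, ih, geomSum]
    ring

theorem Shape.lowerCost_tower (ρ : ℝ) (d k : ℕ) :
    (tower d k).lowerCost ρ = towerCost ρ d k := by
  induction k with
  | zero => simp [tower, lowerCost, towerCost]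
  | succ k ih => rw [tower, lowerCost_spine, ih, towerCost]

theorem Shape.centroidCost_tower (ρ : ℝ) (d k : ℕ) :
    (tower d k).centroidCost ρ =
      (1 + geomSum ρ d) * towerCost ρ d k - geomSum ρ d ^ (k + 1) := by
  induction k with
  | zero => simp [tower, centroidCost, towerCost]
  | succ k ih =>
    rw [tower, centroidCost_spine, ih, towerCost]
    ring

theorem geomSum_nonneg {ρ : ℝ} (hρ : 0 ≤ ρ) (m : ℕ) : 0 ≤ geomSum ρ m := by
  induction m with
  | zero => exact le_rfl
  | succ m ih => exact add_nonneg hρ (mul_nonneg hρ ih)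

theorem geomSum_half (m : ℕ) : geomSum (1 / 2) m = 1 - 1 / 2 ^ m := by
  induction m with
  | zero => simp [geomSum]
  | succ m ih =>
    rw [geomSum, ih]
    field_simp
    ring

theorem geomSum_le_geomSum {ρ ρ' : ℝ} (hρ : 0 ≤ ρ) (h : ρ ≤ ρ') (m : ℕ) :
    geomSum ρ m ≤ geomSum ρ' m := by
  induction m with
  | zero => exact le_rfl
  | succ m ih =>
    exact add_le_add h (mul_le_mul h ih (geomSum_nonneg hρ m) (hρ.trans h))

theorem continuous_geomSum (m : ℕ) : Continuous fun ρ => geomSum ρ m := by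
  induction m with
  | zero => exact continuous_const
  | succ m ih =>
    simp only [geomSum]
    fun_prop

theorem one_le_towerCost {ρ : ℝ} (hρ : 0 ≤ ρ) (d k : ℕ) : 1 ≤ towerCost ρ d k := by
  induction k with
  | zero => exact le_rfl
  | succ k ih =>
    rw [towerCost]
    have := mul_nonneg (geomSum_nonneg hρ d) (zero_le_one.trans ih)
    linarith

/-- `q` is disjoint from `s`, attached to it only at `p`, and connected together with `p`. -/
structure IsPendant (G : SimpleGraph V) (s : Set V) (p : V) (q : Set V) : Prop where
  disjoint : Disjoint s q
  connIn : ConnIn G (insert p q)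
  eq_of_adj : ∀ v ∈ s, ∀ u ∈ q, G.Adj v u → v = p

/-- Every block of shape `t` has, together with any pendant set of weight `0`, a search tree of cost
at most `u` times its weight, where costs are taken with respect to `w'`. -/
def HasSearchTreeOfCostLE (G : SimpleGraph V) (w w' : V → ℝ) (ρ : ℝ) (t : Shape) (u : ℝ) : Prop :=
  ∀ (s : Set V) (W : ℝ) (p x : V) (q : Set V), 0 ≤ W → IsBlock G w w' ρ t s W p x →
    IsPendant G s p q → (∀ v ∈ q, w' v = 0) →
    ∃ T, IsSearchTree G (s ∪ q) T ∧ cost w' T ≤ W * u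

section Upper

variable {G : SimpleGraph V} {w w' : V → ℝ} {ρ : ℝ}

theorem isPendant_empty {s : Set V} {p : V} : IsPendant G s p ∅ :=
  ⟨Set.disjoint_empty _, by simpa using connIn_singleton, by simp⟩

theorem IsBlock.wsum_le [Finite V] {t : Shape} {s q : Set V} {W : ℝ} {p x : V}
    (h : IsBlock G w w' ρ t s W p x) (hρ : 0 ≤ ρ) (hρ' : ρ ≤ 1 / 2) (hW : 0 ≤ W)
    (hq : IsPendant G s p q) (hq₀ : ∀ v ∈ q, w' v = 0) : wsum w' (s ∪ q) ≤ W := by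
  have hb := h.weight_bounds hρ hρ' hW
  have h0 : wsum w' q = 0 := finsum_mem_of_eqOn_zero hq₀
  rw [wsum_union hq.disjoint, h0, add_zero, ← h.wsum_eq]
  exact wsum_le_wsum Set.Subset.rfl (fun v hv => (hb v hv).2.1)
    fun v hv => (hb v hv).1.trans (hb v hv).2.1

theorem exists_isSearchForest_join {r : Shape} {u v W : ℝ}
    (hr' : HasSearchTreeOfCostLE G w w' ρ r u)
    {S R q : Set V} {c x b y : V} (hxS : x ∈ S) (hρW : 0 ≤ ρ * W)
    (hr : IsBlock G w w' ρ r R (ρ * W) b y) (hcS : c ∉ S) (hcR : c ∉ R) (hSR : Disjoint S R)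
    (hno : ∀ u ∈ S, ∀ v ∈ R, ¬ G.Adj u v) (hcx : ∀ v ∈ S, G.Adj c v ↔ v = x)
    (hcb : ∀ v ∈ R, G.Adj c v ↔ v = b) (hw' : w' c = 0) (hq : IsPendant G (insert c (S ∪ R)) c q)
    (hq₀ : ∀ v ∈ q, w' v = 0) {ts : List (RTree V)} (hts : IsSearchForest G (S \ {x}) ts)
    (hv : (ts.map (cost w')).sum ≤ v) :
    ∃ ts', IsSearchForest G ((insert c (S ∪ R) ∪ q) \ {x}) ts' ∧
      (ts'.map (cost w')).sum ≤ v + ρ * W * u := by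
  have hbR := hr.port_mem
  have hqS : ∀ v ∈ S, v ∉ q := fun v hv =>
    Set.disjoint_left.1 hq.disjoint (Or.inr (Or.inl hv))
  have hqR : ∀ v ∈ R, v ∉ q := fun v hv =>
    Set.disjoint_left.1 hq.disjoint (Or.inr (Or.inr hv))
  have hcq : c ∉ q := Set.disjoint_left.1 hq.disjoint (Or.inl rfl)
  have hp : IsPendant G R b (insert c q) := by
    refine ⟨?_, ?_, ?_⟩
    · rw [Set.disjoint_left]
      rintro v hv (rfl | hvq)
      · exact hcR hv
      · exact hqR v hv hvq
    · have := connIn_singleton.union_of_adj hq.connIn (x := b) (y := c) rfl (Or.inl rfl)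
        ((hcb b hbR).2 rfl).symm
      rwa [Set.singleton_union] at this
    · rintro v hv z (rfl | hz) hvz
      · exact (hcb v hv).1 hvz.symm
      · obtain rfl := hq.eq_of_adj v (Or.inr (Or.inr hv)) z hz hvz
        exact (hcR hv).elim
  obtain ⟨T, hT, hTu⟩ := hr' R (ρ * W) b y (insert c q) hρW hr hp (by
    rintro v (rfl | hv)
    · exact hw'
    · exact hq₀ v hv)
  have hTc : ConnIn G (R ∪ insert c q) :=
    hr.connIn.union_of_adj hq.connIn hbR (Or.inl rfl) ((hcb b hbR).2 rfl).symm
  have hf := hts.append (hT.isSearchForest hTc) ?_ ?_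
  · refine ⟨ts ++ [T], ?_, ?_⟩
    · convert hf using 1
      ext v
      have h1 : v = x → v ∈ S := fun h => h ▸ hxS
      have h2 : v ∈ S → v ∉ R := fun h => Set.disjoint_left.1 hSR h
      have h3 := hqS v
      have h4 : v = c → v ∉ S := fun h => h ▸ hcS
      simp only [Set.mem_sdiff, Set.mem_union, Set.mem_insert_iff, Set.mem_singleton_iff]
      tauto
    · simp only [List.map_append, List.sum_append, List.map_cons, List.map_nil, List.sum_singleton]
      linarith
  · rw [Set.disjoint_left]
    rintro v ⟨hv, -⟩ (hvR | rfl | hvq)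
    · exact Set.disjoint_left.1 hSR hv hvR
    · exact hcS hv
    · exact hqS v hv hvq
  · rintro v ⟨hv, hvx⟩ z (hz | rfl | hz) hvz
    · exact hno v hv z hz hvz
    · exact hvx ((hcx v hv).1 hvz.symm)
    · obtain rfl := hq.eq_of_adj v (Or.inr (Or.inl hv)) z hz hvz
      exact hcS hv

theorem exists_isSearchForest_spine {b : Shape} {u : ℝ}
    (hb : HasSearchTreeOfCostLE G w w' ρ b u) (hρ : 0 ≤ ρ) {m : ℕ} {s : Set V} {W : ℝ} {p x : V}
    (hW : 0 ≤ W) (h : IsBlock G w w' ρ (b.spine m) s W p x) :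
    ∃ ts, IsSearchForest G (s \ {x}) ts ∧ (ts.map (cost w')).sum ≤ W * (geomSum ρ m * u) := by
  induction m generalizing s W p x with
  | zero =>
    rw [Shape.spine] at h
    cases h
    exact ⟨[], ⟨by simp, by simp, by simp⟩, by simp [geomSum]⟩
  | succ m ih =>
    rw [Shape.spine] at h
    cases h with
    | join hl hr hcS hcR hSR hno hcx hcb hw hw' =>
      have hρW := mul_nonneg hρ hW
      obtain ⟨ts, hts, hv⟩ := ih hρW hl
      obtain ⟨ts', hts', hv'⟩ := exists_isSearchForest_join hb hl.center_mem hρW hr hcS hcR hSR hno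
        hcx hcb hw' isPendant_empty (by simp) hts hv
      rw [Set.union_empty] at hts'
      refine ⟨ts', hts', hv'.trans_eq ?_⟩
      rw [geomSum]
      ring

theorem hasSearchTreeOfCostLE_leaf [Finite V] : HasSearchTreeOfCostLE G w w' ρ .leaf 1 := by
  intro s W p x q hW h hq hq₀
  cases h with
  | leaf h h' =>
    obtain ⟨ts, hts⟩ := exists_isSearchForest G (({p} ∪ q) \ {p})
    have hT : IsSearchTree G ({p} ∪ q) (.node p ts) :=
      isSearchTree_node_iff.2 ⟨Or.inl rfl, hts⟩
    refine ⟨_, hT, ?_⟩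
    rw [hT.cost_node, wsum_union hq.disjoint, wsum_singleton, h',
      show wsum w' q = 0 from finsum_mem_of_eqOn_zero hq₀, List.sum_eq_zero]
    · simp
    · intro z hz
      obtain ⟨t, ht, rfl⟩ := List.mem_map.1 hz
      refine finsum_mem_of_eqOn_zero fun v hv => ?_
      obtain ⟨hv1 | hv1, hv2⟩ := (hts.exists_mem_iff v).1 ⟨t, ht, hv⟩
      · exact (hv2 hv1).elim
      · simp [hq₀ v hv1]

theorem hasSearchTreeOfCostLE_spine [Finite V] {b : Shape} {u : ℝ}
    (hb : HasSearchTreeOfCostLE G w w' ρ b u) (hρ : 0 ≤ ρ) (hρ' : ρ ≤ 1 / 2) (m : ℕ) :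
    HasSearchTreeOfCostLE G w w' ρ (b.spine (m + 1)) (1 + geomSum ρ (m + 1) * u) := by
  intro s W p x q hW h hq hq₀
  have hws := h.wsum_le hρ hρ' hW hq hq₀
  have hxs := h.center_mem
  rw [Shape.spine] at h
  cases h with
  | join hl hr hcS hcR hSR hno hcx hcb hw hw' =>
    have hρW := mul_nonneg hρ hW
    obtain ⟨ts, hts, hv⟩ := exists_isSearchForest_spine hb hρ hρW hl
    obtain ⟨ts', hts', hv'⟩ := exists_isSearchForest_join hb hl.center_mem hρW hr hcS hcR hSR hno
      hcx hcb hw' hq hq₀ hts hv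
    have hT : IsSearchTree G (_ ∪ q) (.node x ts') :=
      isSearchTree_node_iff.2 ⟨Or.inl hxs, hts'⟩
    refine ⟨_, hT, ?_⟩
    rw [hT.cost_node, geomSum]
    linarith

theorem hasSearchTreeOfCostLE_tower [Finite V] {d : ℕ} (hd : d ≠ 0) (hρ : 0 ≤ ρ)
    (hρ' : ρ ≤ 1 / 2) (k : ℕ) :
    HasSearchTreeOfCostLE G w w' ρ (.tower d k) (towerCost ρ d k) := by
  obtain ⟨m, rfl⟩ := Nat.exists_eq_succ_of_ne_zero hd
  induction k with
  | zero => exact hasSearchTreeOfCostLE_leaf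
  | succ k ih => exact hasSearchTreeOfCostLE_spine ih hρ hρ' m

end Upper

section Structure

variable {G : SimpleGraph V} {w w' : V → ℝ} {ρ : ℝ}

theorem IsBlock.map {V' : Type u} {G' : SimpleGraph V'} {v v' : V' → ℝ} {t : Shape} {s : Set V}
    {W : ℝ} {p x : V} (h : IsBlock G w w' ρ t s W p x) {f : V → V'} (hf : Function.Injective f)
    (hadj : ∀ a b, G'.Adj (f a) (f b) ↔ G.Adj a b) (hv : ∀ a, v (f a) = w a)
    (hv' : ∀ a, v' (f a) = w' a) : IsBlock G' v v' ρ t (f '' s) W (f p) (f x) := by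
  induction h with
  | leaf h h' =>
    rw [Set.image_singleton]
    exact .leaf ((hv _).trans h) ((hv' _).trans h')
  | join hl hr hcS hcR hSR hno hcx hcb hw hw' ihl ihr =>
    rw [Set.image_insert_eq, Set.image_union]
    refine .join ihl ihr ?_ ?_ ((Set.disjoint_image_iff hf).2 hSR) ?_ ?_ ?_ ((hv _).trans hw)
      ((hv' _).trans hw')
    · rwa [hf.mem_set_image]
    · rwa [hf.mem_set_image]
    · rintro _ ⟨a, ha, rfl⟩ _ ⟨b, hb, rfl⟩
      rw [hadj]
      exact hno a ha b hb
    · rintro _ ⟨a, ha, rfl⟩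
      rw [hadj, hcx a ha, hf.eq_iff]
    · rintro _ ⟨a, ha, rfl⟩
      rw [hadj, hcb a ha, hf.eq_iff]

theorem IsBlock.ncard_neighborSet_spine [Finite V] {b : Shape} {d : ℕ} (hd : 3 ≤ d)
    (hb : ∀ s W p x, IsBlock G w w' ρ b s W p x →
      (∀ v ∈ s, (G.neighborSet v ∩ s).ncard ≤ d) ∧ (G.neighborSet p ∩ s).ncard ≤ 2)
    {m : ℕ} (hm : m ≤ d) {s : Set V} {W : ℝ} {p x : V} (h : IsBlock G w w' ρ (b.spine m) s W p x) :
    (∀ v ∈ s, (G.neighborSet v ∩ s).ncard ≤ d) ∧ (G.neighborSet p ∩ s).ncard ≤ 2 ∧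
      (G.neighborSet x ∩ s).ncard ≤ m := by
  induction m generalizing s W p x with
  | zero =>
    rw [Shape.spine] at h
    cases h with
    | leaf =>
      have : G.neighborSet p ∩ {p} = ∅ := by simp
      simp [this]
  | succ m ih =>
    rw [Shape.spine] at h
    cases h with
    | @join l r S R W c a x b y hl hr hcS hcR hSR hno hcx hcb hw hw' =>
      obtain ⟨hS, -, hx⟩ := ih (by omega) hl
      obtain ⟨hR, hp⟩ := hb _ _ _ _ hr
      have hc : (G.neighborSet p ∩ insert p (S ∪ R)).ncard ≤ 2 := by
        refine (Set.ncard_le_ncard (t := {x, b}) ?_).trans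
          ((Set.ncard_insert_le _ _).trans (by rw [Set.ncard_singleton]))
        rintro v ⟨hv, rfl | hvS | hvR⟩
        · exact (G.irrefl hv).elim
        · exact Or.inl ((hcx v hvS).1 hv)
        · exact Or.inr ((hcb v hvR).1 hv)
      have hx' : (G.neighborSet x ∩ insert p (S ∪ R)).ncard ≤ m + 1 := by
        refine (Set.ncard_le_ncard (t := insert p (G.neighborSet x ∩ S)) ?_).trans
          ((Set.ncard_insert_le _ _).trans (Nat.succ_le_succ hx))
        rintro v ⟨hv, rfl | hvS | hvR⟩
        · exact Or.inl rfl
        · exact Or.inr ⟨hv, hvS⟩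
        · exact (hno x hl.center_mem v hvR hv).elim
      refine ⟨?_, hc, hx'⟩
      rintro v (rfl | hvS | hvR)
      · omega
      · by_cases hvx : v = x
        · subst hvx
          exact hx'.trans hm
        · refine (Set.ncard_le_ncard ?_).trans (hS v hvS)
          rintro z ⟨hz, rfl | hzS | hzR⟩
          · exact (hvx ((hcx v hvS).1 hz.symm)).elim
          · exact ⟨hz, hzS⟩
          · exact (hno v hvS z hzR hz).elim
      · by_cases hvb : v = b
        · subst hvb
          refine (Set.ncard_le_ncard (t := insert p (G.neighborSet v ∩ R)) ?_).trans
            ((Set.ncard_insert_le _ _).trans ((Nat.succ_le_succ hp).trans hd))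
          rintro z ⟨hz, rfl | hzS | hzR⟩
          · exact Or.inl rfl
          · exact (hno z hzS v hvR hz.symm).elim
          · exact Or.inr ⟨hz, hzR⟩
        · refine (Set.ncard_le_ncard ?_).trans (hR v hvR)
          rintro z ⟨hz, rfl | hzS | hzR⟩
          · exact (hvb ((hcb v hvR).1 hz.symm)).elim
          · exact (hno z hzS v hvR hz.symm).elim
          · exact ⟨hz, hzR⟩

theorem IsBlock.ncard_neighborSet_tower [Finite V] {d : ℕ} (hd : 3 ≤ d) {k : ℕ} {s : Set V}
    {W : ℝ} {p x : V} (h : IsBlock G w w' ρ (.tower d k) s W p x) :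
    (∀ v ∈ s, (G.neighborSet v ∩ s).ncard ≤ d) ∧ (G.neighborSet p ∩ s).ncard ≤ 2 := by
  induction k generalizing s W p x with
  | zero =>
    have := IsBlock.ncard_neighborSet_spine (b := .leaf) (m := 0) hd (fun s W p x h => ?_)
      (Nat.zero_le d) h
    · exact ⟨this.1, this.2.1⟩
    · cases h with
      | leaf =>
        have : G.neighborSet p ∩ {p} = ∅ := by simp
        simp [this]
  | succ k ih =>
    have := IsBlock.ncard_neighborSet_spine hd (fun s W p x h => ih h) le_rfl h
    exact ⟨this.1, this.2.1⟩

theorem IsBlock.ncard_edges_lt [Finite V] {t : Shape} {s : Set V} {W : ℝ} {p x : V}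
    (h : IsBlock G w w' ρ t s W p x) :
    {e ∈ G.edgeSet | ∀ v ∈ e, v ∈ s}.ncard < s.ncard := by
  induction h with
  | @leaf x W h h' =>
    have : {e ∈ G.edgeSet | ∀ v ∈ e, v ∈ ({x} : Set V)} = ∅ := by
      ext e
      induction e with
      | _ a b =>
        simp only [Set.mem_ofPred_eq, SimpleGraph.mem_edgeSet, Sym2.mem_iff, forall_eq_or_imp,
          forall_eq, Set.mem_singleton_iff, Set.mem_empty_iff_false, iff_false]
        rintro ⟨hab, rfl, rfl⟩
        exact G.irrefl hab
    rw [this, Set.ncard_empty, Set.ncard_singleton]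
    exact zero_lt_one
  | @join l r S R W c a x b y hl hr hcS hcR hSR hno hcx hcb hw hw' ihl ihr =>
    have hsub : {e ∈ G.edgeSet | ∀ v ∈ e, v ∈ insert c (S ∪ R)} ⊆
        {s(c, x), s(c, b)} ∪
          ({e ∈ G.edgeSet | ∀ v ∈ e, v ∈ S} ∪ {e ∈ G.edgeSet | ∀ v ∈ e, v ∈ R}) := by
      intro e
      induction e with
      | _ a a' =>
        simp only [Set.mem_ofPred_eq, SimpleGraph.mem_edgeSet, Sym2.mem_iff, forall_eq_or_imp,
          forall_eq, Set.mem_union, Set.mem_insert_iff, Set.mem_singleton_iff]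
        rintro ⟨haa, rfl | ha | ha, rfl | ha' | ha'⟩
        · exact (G.irrefl haa).elim
        · rw [(hcx a' ha').1 haa]
          exact Or.inl (Or.inl rfl)
        · rw [(hcb a' ha').1 haa]
          exact Or.inl (Or.inr rfl)
        · rw [(hcx a ha).1 haa.symm, Sym2.eq_swap]
          exact Or.inl (Or.inl rfl)
        · exact Or.inr (Or.inl ⟨haa, ha, ha'⟩)
        · exact (hno a ha a' ha' haa).elim
        · rw [(hcb a ha).1 haa.symm, Sym2.eq_swap]
          exact Or.inl (Or.inr rfl)
        · exact (hno a' ha' a ha haa.symm).elim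
        · exact Or.inr (Or.inr ⟨haa, ha, ha'⟩)
    have h1 := Set.ncard_le_ncard hsub (Set.toFinite _)
    have h2 := Set.ncard_union_le {s(c, x), s(c, b)}
      ({e ∈ G.edgeSet | ∀ v ∈ e, v ∈ S} ∪ {e ∈ G.edgeSet | ∀ v ∈ e, v ∈ R})
    have h3 := Set.ncard_union_le {e ∈ G.edgeSet | ∀ v ∈ e, v ∈ S}
      {e ∈ G.edgeSet | ∀ v ∈ e, v ∈ R}
    have h4 := Set.ncard_insert_le s(c, x) {s(c, b)}
    rw [Set.ncard_singleton] at h4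
    rw [Set.ncard_insert_of_notMem (by simp [hcS, hcR]), Set.ncard_union_eq hSR]
    omega

theorem IsBlock.isTree [Finite V] {t : Shape} {W : ℝ} {p x : V}
    (h : IsBlock G w w' ρ t Set.univ W p x) : G.IsTree := by
  have hconn : G.Connected := by
    have : Nonempty V := ⟨p⟩
    refine ⟨fun a b => ?_⟩
    obtain ⟨q, -⟩ := h.connIn.2 a trivial b trivial
    exact ⟨q⟩
  rw [SimpleGraph.isTree_iff_connected_and_card]
  refine ⟨hconn, le_antisymm ?_ hconn.card_vert_le_card_edgeSet_add_one⟩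
  have := h.ncard_edges_lt
  simpa [Set.ncard_univ] using this

/-- The graph obtained from the disjoint union of two graphs by adding a vertex `none` that is
adjacent to the vertex `x` of the first graph and to the vertex `b` of the second one. -/
def joinGraph {V₁ V₂ : Type*} (G₁ : SimpleGraph V₁) (G₂ : SimpleGraph V₂) (x : V₁) (b : V₂) :
    SimpleGraph (Option (V₁ ⊕ V₂)) where
  Adj
    | some (.inl u), some (.inl v) => G₁.Adj u v
    | some (.inr u), some (.inr v) => G₂.Adj u v
    | none, some (.inl v) => v = x
    | some (.inl v), none => v = x
    | none, some (.inr v) => v = b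
    | some (.inr v), none => v = b
    | _, _ => False
  symm := ⟨by
    rintro (_ | u | u) (_ | v | v) h <;> first | exact h | exact h.symm⟩
  loopless := ⟨by
    rintro (_ | u | u) h
    · exact h
    · exact G₁.irrefl h
    · exact G₂.irrefl h⟩

theorem exists_isBlock (ρ : ℝ) (t : Shape) (W : ℝ) :
    ∃ (V : Type) (_ : Fintype V) (G : SimpleGraph V) (w w' : V → ℝ) (p x : V),
      IsBlock G w w' ρ t Set.univ W p x := by
  induction t generalizing W with
  | leaf =>
    refine ⟨Unit, inferInstance, ⊥, fun _ => W, fun _ => W, (), (), ?_⟩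
    rw [Set.univ_unique]
    exact .leaf rfl rfl
  | join l r ihl ihr =>
    obtain ⟨V₁, _, G₁, w₁, w₁', a, x, h₁⟩ := ihl (ρ * W)
    obtain ⟨V₂, _, G₂, w₂, w₂', b, y, h₂⟩ := ihr (ρ * W)
    refine ⟨Option (V₁ ⊕ V₂), inferInstance, joinGraph G₁ G₂ x b,
      fun v => v.elim ((1 - 2 * ρ) * W) (Sum.elim w₁ w₂), fun v => v.elim 0 (Sum.elim w₁' w₂'),
      none, some (.inl x), ?_⟩
    have e : (Set.univ : Set (Option (V₁ ⊕ V₂))) = insert none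
        ((fun v => some (Sum.inl v)) '' Set.univ ∪ (fun v => some (Sum.inr v)) '' Set.univ) := by
      ext (_ | v | v) <;> simp
    rw [e]
    refine .join (h₁.map ?_ ?_ ?_ ?_) (h₂.map ?_ ?_ ?_ ?_) ?_ ?_ ?_ ?_ ?_ ?_ rfl rfl
    · exact (Option.some_injective _).comp Sum.inl_injective
    · exact fun _ _ => Iff.rfl
    · exact fun _ => rfl
    · exact fun _ => rfl
    · exact (Option.some_injective _).comp Sum.inr_injective
    · exact fun _ _ => Iff.rfl
    · exact fun _ => rfl
    · exact fun _ => rfl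
    · simp
    · simp
    · rw [Set.disjoint_left]
      rintro _ ⟨u, -, rfl⟩ ⟨v, -, h⟩
      simp at h
    · rintro _ ⟨u, -, rfl⟩ _ ⟨v, -, rfl⟩ h
      exact h
    · rintro _ ⟨u, -, rfl⟩
      change u = x ↔ _
      simp
    · rintro _ ⟨u, -, rfl⟩
      change u = b ↔ _
      simp

end Structure

theorem cost_nonneg {w : V → ℝ} (hw : ∀ v, 0 ≤ w v) (T : RTree V) : 0 ≤ cost w T :=
  finsum_nonneg fun v => finsum_nonneg fun _ => mul_nonneg (hw v) (Nat.cast_nonneg _)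

theorem IsBlock.lowerCost_le_cost [Finite V] {G : SimpleGraph V} {w w' : V → ℝ} {ρ W : ℝ}
    {t : Shape} {s : Set V} {p x : V} (h : IsBlock G w w' ρ t s W p x) (hw₀ : ∀ v, 0 ≤ w v)
    (hρ : 0 ≤ ρ) (hW : 0 ≤ W) {T : RTree V} (hT : IsSearchTree G s T) :
    W * t.lowerCost ρ ≤ cost w T := by
  have := h.lowerCost_le hw₀ hρ hW (P := fun v => T.pathSet v ∪ sᶜ) fun S hS => by
    by_cases hSs : S ⊆ s
    · obtain ⟨y, hy, hyS⟩ := hT.exists_top hS hSs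
      exact ⟨y, hy, fun v hv => Or.inl (hyS v hv)⟩
    · obtain ⟨y, hy, hys⟩ := Set.not_subset.1 hSs
      exact ⟨y, hy, fun v _ => Or.inr hys⟩
  rw [cost, hT.vertSet_eq]
  refine this.trans_eq (finsum_mem_congr rfl fun v _ => ?_)
  rw [RTree.depth, Set.union_inter_distrib_right, Set.compl_inter_self, Set.union_empty,
    Set.inter_eq_left.2 (hT.pathSet_subset v)]

theorem cost_le_cost_add [Finite V] {w w' : V → ℝ} {δ : ℝ} (hδ : 0 ≤ δ) (hw' : ∀ v, 0 ≤ w' v)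
    (h : ∀ v, w v ≤ w' v + δ) (T : RTree V) : cost w T ≤ cost w' T + δ * (Nat.card V : ℝ) ^ 2 := by
  have hd : ∀ v, (T.depth v : ℝ) ≤ Nat.card V := fun v => by
    exact_mod_cast Set.ncard_le_card _
  have h1 : wsum (fun v => w v * (T.depth v : ℝ)) T.vertSet ≤
      wsum (fun v => w' v * (T.depth v : ℝ) + δ * Nat.card V) T.vertSet := by
    refine wsum_le_wsum Set.Subset.rfl (fun v _ => ?_) fun v _ => ?_
    · have := mul_le_mul_of_nonneg_right (h v) (Nat.cast_nonneg (α := ℝ) (T.depth v))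
      have := mul_le_mul_of_nonneg_left (hd v) hδ
      linarith
    · have := hw' v
      positivity
  have h2 : wsum (fun _ => δ * (Nat.card V : ℝ)) T.vertSet ≤ δ * (Nat.card V : ℝ) ^ 2 := by
    rw [wsum, finsum_mem_eq_finite_toFinset_sum _ (Set.toFinite _), Finset.sum_const,
      ← Set.ncard_eq_toFinset_card, nsmul_eq_mul]
    have : (T.vertSet.ncard : ℝ) ≤ Nat.card V := by exact_mod_cast Set.ncard_le_card _
    have := mul_le_mul_of_nonneg_right this (mul_nonneg hδ (Nat.cast_nonneg (α := ℝ) (Nat.card V)))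
    linarith
  refine h1.trans ?_
  rw [wsum, finsum_mem_add_distrib (Set.toFinite _)]
  exact add_le_add_right h2 _

theorem IsBlock.OPT_tower_bounds [Finite V] {G : SimpleGraph V} {w w' : V → ℝ} {ρ : ℝ} {d k : ℕ}
    {p x : V} (h : IsBlock G w w' ρ (.tower d k) Set.univ 1 p x) (hd : d ≠ 0) (hρ : 0 ≤ ρ)
    (hρ' : ρ ≤ 1 / 2) :
    towerCost ρ d k ≤ OPT G w Set.univ ∧
      OPT G w Set.univ ≤ towerCost ρ d k + (1 - 2 * ρ) * ((Shape.tower d k).size : ℝ) ^ 2 := by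
  have hb := fun v => h.weight_bounds hρ hρ' zero_le_one v trivial
  have hw₀ : ∀ v, 0 ≤ w v := fun v => (hb v).1.trans (hb v).2.1
  obtain ⟨T, hT, hTc⟩ := hasSearchTreeOfCostLE_tower hd hρ hρ' k Set.univ 1 p x ∅ zero_le_one h
    isPendant_empty (by simp)
  rw [Set.union_empty] at hT
  rw [one_mul] at hTc
  constructor
  · refine le_csInf ⟨_, T, hT, rfl⟩ ?_
    rintro _ ⟨T', hT', rfl⟩
    rw [← Shape.lowerCost_tower, ← one_mul (Shape.lowerCost _ _)]
    exact h.lowerCost_le_cost hw₀ hρ zero_le_one hT'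
  · have hbdd : BddBelow (cost w '' {T | IsSearchTree G Set.univ T}) := by
      refine ⟨0, ?_⟩
      rintro _ ⟨T', -, rfl⟩
      exact cost_nonneg hw₀ T'
    refine (csInf_le hbdd ⟨T, hT, rfl⟩).trans ?_
    refine (cost_le_cost_add (δ := 1 - 2 * ρ) (by linarith) (fun v => (hb v).1)
      (fun v => by simpa using (hb v).2.2) T).trans ?_
    rw [← h.ncard_eq, Set.ncard_univ]
    exact add_le_add_left hTc _

theorem IsBlock.centroidTree_ratio_bounds [Finite V] {G : SimpleGraph V} {w w' : V → ℝ} {ρ : ℝ}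
    {d k : ℕ} {p x : V} (h : IsBlock G w w' ρ (.tower d k) Set.univ 1 p x) (hd : d ≠ 0)
    (hρ : 0 < ρ) (hρ' : ρ < 1 / 2) {C : RTree V} (hC : IsCentroidTree G w Set.univ C) :
    1 + geomSum ρ d - (1 - 1 / 2 ^ d) ^ (k + 1) -
        2 * ((1 - 2 * ρ) * ((Shape.tower d k).size : ℝ) ^ 2) ≤ cost w C / OPT G w Set.univ ∧
      cost w C / OPT G w Set.univ ≤ 1 + geomSum ρ d := by
  have hw₀ : ∀ v, 0 ≤ w v := fun v =>
    have hb := h.weight_bounds hρ.le hρ'.le zero_le_one v trivial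
    hb.1.trans hb.2.1
  obtain ⟨h1, h2⟩ := h.OPT_tower_bounds hd hρ.le hρ'.le
  rw [h.cost_centroidTree hw₀ hρ hρ' one_pos hC, one_mul, Shape.centroidCost_tower]
  have ho := one_le_towerCost hρ.le d k
  have hS := geomSum_nonneg hρ.le d
  have hS' := geomSum_le_geomSum hρ.le hρ'.le d
  rw [geomSum_half] at hS'
  have hpow := pow_le_pow_left₀ hS hS' (k + 1)
  have hpow₀ := pow_nonneg hS (k + 1)
  have hS₁ : geomSum ρ d ≤ 1 := hS'.trans (sub_le_self _ (by positivity))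
  have hε : 0 ≤ (1 - 2 * ρ) * ((Shape.tower d k).size : ℝ) ^ 2 :=
    mul_nonneg (by linarith) (sq_nonneg _)
  generalize (1 - 2 * ρ) * ((Shape.tower d k).size : ℝ) ^ 2 = ε at *
  have hpos : 0 < OPT G w Set.univ := by linarith
  rw [le_div_iff₀ hpos, div_le_iff₀ hpos]
  constructor
  · nlinarith
  · nlinarith

theorem Shape.one_le_size (t : Shape) : 1 ≤ t.size := by
  cases t <;> simp [size]

theorem exists_lower_bound_instance {d : ℕ} (hd : 3 ≤ d) (k : ℕ) {ρ : ℝ} (hρ : 0 < ρ)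
    (hρ' : ρ < 1 / 2) :
    ∃ (V : Type) (_ : Fintype V) (G : SimpleGraph V) (w : V → ℝ),
      G.IsTree ∧ (∀ v, (G.neighborSet v).ncard ≤ d) ∧ (∀ v, 0 ≤ w v) ∧
      ∀ C : RTree V, IsCentroidTree G w Set.univ C →
        1 + geomSum ρ d - (1 - 1 / 2 ^ d) ^ (k + 1) -
            2 * ((1 - 2 * ρ) * ((Shape.tower d k).size : ℝ) ^ 2) ≤ cost w C / OPT G w Set.univ ∧
          cost w C / OPT G w Set.univ ≤ 1 + geomSum ρ d := by
  obtain ⟨V, i, G, w, w', p, x, h⟩ := exists_isBlock ρ (.tower d k) 1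
  refine ⟨V, i, G, w, h.isTree, fun v => ?_, fun v => ?_, fun C hC =>
    h.centroidTree_ratio_bounds (by omega) hρ hρ' hC⟩
  · simpa using (h.ncard_neighborSet_tower hd).1 v trivial
  · have hb := h.weight_bounds hρ.le hρ'.le zero_le_one v trivial
    exact hb.1.trans hb.2.1

theorem lower_bound_bounded_degree (Δ : ℕ) (hΔ : 3 ≤ Δ) :
    ∃ (V : ℕ → Type) (_ : ∀ n, Fintype (V n)) (G : ∀ n, SimpleGraph (V n))
      (w : ∀ n, V n → ℝ),
      (∀ n, (G n).IsTree) ∧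
      (∀ n, ∀ v : V n, ((G n).neighborSet v).ncard ≤ Δ) ∧
      (∀ n x, 0 ≤ w n x) ∧
      (∀ C : (n : ℕ) → RTree (V n), (∀ n, IsCentroidTree (G n) (w n) Set.univ (C n)) →
        Filter.Tendsto (fun n => cost (w n) (C n) / OPT (G n) (w n) Set.univ)
          Filter.atTop (nhds (2 - 1 / 2 ^ Δ))) := by
  set N : ℕ → ℝ := fun n => ((Shape.tower Δ n).size : ℝ) ^ 2 with hN
  have hN₁ : ∀ n, 1 ≤ N n := fun n => by
    have : (1 : ℝ) ≤ (Shape.tower Δ n).size := by exact_mod_cast Shape.one_le_size _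
    exact one_le_pow₀ this
  set ε : ℕ → ℝ := fun n => 1 / ((n : ℝ) + 1 + 1) with hε
  have hε₀ : ∀ n, 0 < ε n := fun n => by positivity
  have hε₁ : ∀ n, ε n ≤ 1 / 2 := fun n => by
    have : (0 : ℝ) ≤ n := Nat.cast_nonneg n
    exact one_div_le_one_div_of_le two_pos (by linarith)
  have hεlim : Tendsto ε atTop (𝓝 0) := by
    have := (tendsto_add_atTop_iff_nat 1).2 (tendsto_one_div_add_atTop_nhds_zero_nat (𝕜 := ℝ))
    simpa [hε] using this
  have hδ₀ : ∀ n, 0 < ε n / N n := fun n => div_pos (hε₀ n) (zero_lt_one.trans_le (hN₁ n))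
  have hδ₁ : ∀ n, ε n / N n ≤ ε n := fun n => div_le_self (hε₀ n).le (hN₁ n)
  set ρ : ℕ → ℝ := fun n => (1 - ε n / N n) / 2 with hρ
  have hρ₀ : ∀ n, 0 < ρ n := fun n => by
    have h1 := hδ₁ n
    have h2 := hε₁ n
    simp only [hρ]
    linarith
  have hρ₁ : ∀ n, ρ n < 1 / 2 := fun n => by
    have := hδ₀ n
    simp only [hρ]
    linarith
  have hρN : ∀ n, (1 - 2 * ρ n) * N n = ε n := fun n => by
    have : N n ≠ 0 := (zero_lt_one.trans_le (hN₁ n)).ne'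
    simp only [hρ]
    field_simp
    ring
  have hρlim : Tendsto ρ atTop (𝓝 (1 / 2)) := by
    have h0 := squeeze_zero (fun n => (hδ₀ n).le) hδ₁ hεlim
    simpa using (h0.const_sub 1).div_const 2
  have hS : Tendsto (fun n => 1 + geomSum (ρ n) Δ) atTop (𝓝 (2 - 1 / 2 ^ Δ)) := by
    have := (((continuous_geomSum Δ).tendsto (1 / 2)).comp hρlim).const_add 1
    rw [geomSum_half, show (1 : ℝ) + (1 - 1 / 2 ^ Δ) = 2 - 1 / 2 ^ Δ by ring] at this
    exact this
  have hpow : Tendsto (fun n => (1 - 1 / 2 ^ Δ : ℝ) ^ (n + 1)) atTop (𝓝 0) := by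
    refine (tendsto_add_atTop_iff_nat 1).2 (tendsto_pow_atTop_nhds_zero_of_lt_one ?_ ?_)
    · rw [← geomSum_half]
      exact geomSum_nonneg (by norm_num) Δ
    · exact sub_lt_self _ (by positivity)
  choose V i G w hG hdeg hw hC using fun n =>
    exists_lower_bound_instance hΔ n (hρ₀ n) (hρ₁ n)
  refine ⟨V, i, G, w, hG, hdeg, hw, fun C hCn => ?_⟩
  refine tendsto_of_tendsto_of_tendsto_of_le_of_le (?_ : Tendsto _ _ _) hS
    (fun n => (hC n (C n) (hCn n)).1) fun n => (hC n (C n) (hCn n)).2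
  have := (hS.sub hpow).sub (hεlim.const_mul 2)
  simp only [sub_zero, mul_zero] at this
  refine this.congr fun n => ?_
  rw [← hρN]
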